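/- arXiv:2111.07757 — 2 statements merged into one kernel-verified Lean document; each statement's English description precedes it below -/
import Mathlib

section
/- Let a ∈ (0,1). Then as x → ∞ (x real), (a/Γ(1−a)) · ∫₀¹ (1 − u^x) · u^{−a} · (1−u)^{−a−1} du + ((2−4a)/Γ(1−a)) · ∫₀¹ (1 − u^x) · u^{1−a} · (1−u)^{−a} du = x^{a} − ((3/2)a² − (9/2)a + 2)·x^{a−1} + O(x^{a−2}). (Both integrals converge for a ∈ (0,1): near u = 1 the factor 1 − u^x vanishes linearly, compensating the singularity of (1−u)^{−a−1}; near u = 0 the exponents −a and 1−a exceed −1.) -/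
open Filter Asymptotics Real

lemma intervalIntegrable_rpow_mul_one_sub_rpow {p q : ℝ} (hp : 0 < p) (hq : 0 < q) :
    IntervalIntegrable (fun u : ℝ => u ^ (p - 1) * (1 - u) ^ (q - 1)) MeasureTheory.volume 0 1 := by
  have h := Complex.betaIntegral_convergent (u := p) (v := q) (by simpa) (by simpa)
  rw [intervalIntegrable_iff_integrableOn_Ioo_of_le zero_le_one] at h ⊢
  refine MeasureTheory.IntegrableOn.congr_fun h.re (fun u hu => ?_) measurableSet_Ioo
  have h1 : (u : ℂ) ^ ((p : ℂ) - 1) = ((u ^ (p - 1) : ℝ) : ℂ) := by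
    rw [Complex.ofReal_cpow hu.1.le]; simp
  have h2 : (1 - (u : ℂ)) ^ ((q : ℂ) - 1) = (((1 - u) ^ (q - 1) : ℝ) : ℂ) := by
    rw [Complex.ofReal_cpow (by linarith [hu.2])]; simp
  simp only [h1, h2]
  rw [← Complex.ofReal_mul]
  simp

lemma integral_rpow_mul_one_sub_rpow {p q : ℝ} (hp : 0 < p) (hq : 0 < q) :
    ∫ u in (0 : ℝ)..1, u ^ (p - 1) * (1 - u) ^ (q - 1) = Gamma p * Gamma q / Gamma (p + q) := by
  change _ = ProbabilityTheory.beta p q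
  rw [ProbabilityTheory.beta_eq_betaIntegralReal p q hp hq, Complex.betaIntegral]
  have h : ∫ u in (0 : ℝ)..1, (u : ℂ) ^ ((p : ℂ) - 1) * (1 - (u : ℂ)) ^ ((q : ℂ) - 1) =
      ∫ u in (0 : ℝ)..1, ((u ^ (p - 1) * (1 - u) ^ (q - 1) : ℝ) : ℂ) := by
    refine intervalIntegral.integral_congr fun u hu => ?_
    rw [Set.uIcc_of_le zero_le_one] at hu
    simp only [Complex.ofReal_mul, Complex.ofReal_cpow hu.1,
      Complex.ofReal_cpow (sub_nonneg.2 hu.2)]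
    simp
  rw [h, intervalIntegral.integral_ofReal, Complex.ofReal_re]

lemma integral_congr_Ioo {f g : ℝ → ℝ} (h : ∀ u ∈ Set.Ioo (0 : ℝ) 1, f u = g u) :
    ∫ u in (0 : ℝ)..1, f u = ∫ u in (0 : ℝ)..1, g u := by
  rw [intervalIntegral.integral_of_le zero_le_one, intervalIntegral.integral_of_le zero_le_one,
    MeasureTheory.integral_Ioc_eq_integral_Ioo, MeasureTheory.integral_Ioc_eq_integral_Ioo]
  exact MeasureTheory.setIntegral_congr_fun measurableSet_Ioo h

lemma integral_one_sub_rpow_mul {p q x : ℝ} (hp : 0 < p) (hq : 0 < q) (hx : 0 ≤ x) :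
    ∫ u in (0 : ℝ)..1, (1 - u ^ x) * u ^ (p - 1) * (1 - u) ^ (q - 1) =
      Gamma p * Gamma q / Gamma (p + q) - Gamma (x + p) * Gamma q / Gamma (x + p + q) := by
  have hxp : 0 < x + p := by linarith
  rw [← integral_rpow_mul_one_sub_rpow hp hq, ← integral_rpow_mul_one_sub_rpow hxp hq,
    ← intervalIntegral.integral_sub (intervalIntegrable_rpow_mul_one_sub_rpow hp hq)
      (intervalIntegrable_rpow_mul_one_sub_rpow hxp hq)]
  refine integral_congr_Ioo fun u hu => ?_
  rw [add_sub_assoc, rpow_add hu.1]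
  ring

lemma one_sub_rpow_mem_Icc {x u : ℝ} (hx : 1 ≤ x) (hu : u ∈ Set.Ioo (0 : ℝ) 1) :
    1 - u ^ x ∈ Set.Icc 0 (x * (1 - u)) := by
  have h := one_add_mul_self_le_rpow_one_add (s := u - 1) (by linarith [hu.1]) hx
  have h' := rpow_le_one hu.1.le hu.2.le (by linarith : 0 ≤ x)
  rw [add_sub_cancel] at h
  constructor <;> linarith

lemma intervalIntegrable_one_sub_rpow_mul {a x : ℝ} (ha : a < 1) (hx : 1 ≤ x) :
    IntervalIntegrable (fun u : ℝ => (1 - u ^ x) * u ^ (-a) * (1 - u) ^ (-a - 1))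
      MeasureTheory.volume 0 1 := by
  have h := (intervalIntegrable_rpow_mul_one_sub_rpow (sub_pos.2 ha) (sub_pos.2 ha)).const_mul x
  rw [intervalIntegrable_iff_integrableOn_Ioo_of_le zero_le_one] at h ⊢
  refine h.mono' (by fun_prop) ?_
  refine (MeasureTheory.ae_restrict_iff' measurableSet_Ioo).2 (.of_forall fun u hu => ?_)
  have h1 := one_sub_rpow_mem_Icc hx hu
  have hu' : 0 < 1 - u := by linarith [hu.2]
  have h2 : 0 < u ^ (-a) := rpow_pos_of_pos hu.1 _
  have h3 : 0 < (1 - u) ^ (-a - 1) := rpow_pos_of_pos hu' _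
  rw [norm_of_nonneg (by have := h1.1; positivity)]
  have h4 : (1 - u) ^ (1 - a - 1) = (1 - u) ^ (-a - 1) * (1 - u) := by
    rw [← rpow_add_one hu'.ne']; ring_nf
  rw [h4, show 1 - a - 1 = -a by ring]
  calc _ ≤ x * (1 - u) * u ^ (-a) * (1 - u) ^ (-a - 1) := by
        have := h1.2
        gcongr
    _ = _ := by ring

lemma mul_integral_one_sub_rpow_mul {a x : ℝ} (ha : a < 1) (hx : 1 ≤ x) :
    a * ∫ u in (0 : ℝ)..1, (1 - u ^ x) * u ^ (-a) * (1 - u) ^ (-a - 1) =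
      (x + 1 - 2 * a) * (Gamma (x + 1 - a) * Gamma (1 - a) / Gamma (x + 2 - 2 * a)) -
      (1 - 2 * a) * (Gamma (1 - a) * Gamma (1 - a) / Gamma (2 - 2 * a)) := by
  have ha' : 0 < 1 - a := sub_pos.2 ha
  have hxa : 0 < x + 1 - a := by linarith
  have i1 := intervalIntegrable_rpow_mul_one_sub_rpow ha' ha'
  have i2 := intervalIntegrable_rpow_mul_one_sub_rpow hxa ha'
  have i3 := intervalIntegrable_one_sub_rpow_mul ha hx
  have v1 := integral_rpow_mul_one_sub_rpow ha' ha'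
  have v2 := integral_rpow_mul_one_sub_rpow hxa ha'
  have hint := ((i1.const_mul (1 - 2 * a)).sub (i2.const_mul (x + 1 - 2 * a))).add (i3.const_mul a)
  have hT : ∀ u ∈ Set.Ioo (0 : ℝ) 1,
      |(1 - u ^ x) * u ^ (1 - a) * (1 - u) ^ (-a)| ≤ x * u ^ (1 - a) * (1 - u) ^ (1 - a) := by
    intro u hu
    have hu' : 0 < 1 - u := by linarith [hu.2]
    have h1 := one_sub_rpow_mem_Icc hx hu
    have h2 : 0 < u ^ (1 - a) := rpow_pos_of_pos hu.1 _
    have h3 : 0 < (1 - u) ^ (-a) := rpow_pos_of_pos hu' _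
    rw [abs_of_nonneg (by have := h1.1; positivity),
      show 1 - a = -a + 1 by ring, rpow_add_one hu'.ne', ← show 1 - a = -a + 1 by ring]
    calc _ ≤ x * (1 - u) * u ^ (1 - a) * (1 - u) ^ (-a) := by
          have := h1.2
          gcongr
      _ = _ := by ring
  have hC : Continuous fun u : ℝ => x * u ^ (1 - a) * (1 - u) ^ (1 - a) :=
    (continuous_const.mul (continuous_id.rpow_const fun _ => .inr ha'.le)).mul
      ((continuous_const.sub continuous_id).rpow_const fun _ => .inr ha'.le)
  have hF := intervalIntegral.integral_eq_sub_of_hasDerivAt_of_tendsto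
    (f := fun u : ℝ => (1 - u ^ x) * u ^ (1 - a) * (1 - u) ^ (-a)) (fa := 0) (fb := 0)
    zero_lt_one (fun u hu => ?_) hint ?_ ?_
  · rw [intervalIntegral.integral_add ((i1.const_mul _).sub (i2.const_mul _)) (i3.const_mul _),
      intervalIntegral.integral_sub (i1.const_mul _) (i2.const_mul _),
      intervalIntegral.integral_const_mul, intervalIntegral.integral_const_mul,
      intervalIntegral.integral_const_mul, v1, v2] at hF
    rw [show x + 2 - 2 * a = x + 1 - a + (1 - a) by ring,
      show 2 - 2 * a = 1 - a + (1 - a) by ring]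
    linarith
  · have hu' : 0 < 1 - u := by linarith [hu.2]
    have d1 := (Real.hasDerivAt_rpow_const (x := u) (p := x) (.inl hu.1.ne')).const_sub 1
    have d2 := Real.hasDerivAt_rpow_const (x := u) (p := 1 - a) (.inl hu.1.ne')
    have d3 := ((hasDerivAt_id u).const_sub 1).rpow_const (p := -a) (.inl hu'.ne')
    refine ((d1.mul d2).mul d3).congr_deriv ?_
    simp only [id, Pi.mul_apply]
    rw [show 1 - a - 1 = -a by ring, show x + 1 - a - 1 = x + -a by ring, rpow_add hu.1,
      rpow_sub_one hu.1.ne', show 1 - a = -a + 1 by ring, rpow_add_one hu.1.ne',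
      show (1 - u) ^ (-a) = (1 - u) ^ (-a - 1) * (1 - u) by
        rw [← rpow_add_one hu'.ne']; ring_nf]
    have := hu.1.ne'
    field_simp
    ring
  · refine squeeze_zero_norm' (a := fun u : ℝ => x * u ^ (1 - a) * (1 - u) ^ (1 - a)) ?_ ?_
    · filter_upwards [Ioo_mem_nhdsGT zero_lt_one] with u hu using hT u hu
    · have := hC.tendsto 0
      simp only [zero_rpow ha'.ne', mul_zero, zero_mul] at this
      exact this.mono_left nhdsWithin_le_nhds
  · refine squeeze_zero_norm' (a := fun u : ℝ => x * u ^ (1 - a) * (1 - u) ^ (1 - a)) ?_ ?_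
    · filter_upwards [Ioo_mem_nhdsLT zero_lt_one] with u hu using hT u hu
    · have := hC.tendsto 1
      simp only [sub_self, zero_rpow ha'.ne', mul_zero] at this
      exact this.mono_left nhdsWithin_le_nhds

lemma ford_phi_eq {a x : ℝ} (ha : a < 1) (hx : 1 ≤ x) :
    (a / Gamma (1 - a)) *
        (∫ u in (0 : ℝ)..1, (1 - u ^ x) * u ^ (-a) * (1 - u) ^ (-a - 1)) +
      ((2 - 4 * a) / Gamma (1 - a)) *
        (∫ u in (0 : ℝ)..1, (1 - u ^ x) * u ^ (1 - a) * (1 - u) ^ (-a)) =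
      Gamma (x + 1 - 2 * a + a) / Gamma (x + 1 - 2 * a) *
        (1 - (2 - 4 * a) * (x + 1 - a) / ((x + 1 - 2 * a) * (x + 2 - 2 * a))) := by
  have ha' : 0 < 1 - a := sub_pos.2 ha
  have hG := (Gamma_pos_of_pos ha').ne'
  have h1 := mul_integral_one_sub_rpow_mul ha hx
  have h2 := integral_one_sub_rpow_mul (p := 2 - a) (q := 1 - a) (x := x) (by linarith) ha'
    (by linarith)
  rw [show 2 - a - 1 = 1 - a by ring, show 1 - a - 1 = -a by ring,
    show 2 - a + (1 - a) = 2 - 2 * a + 1 by ring, show 2 - a = 1 - a + 1 by ring,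
    show x + (1 - a + 1) + (1 - a) = x + 2 - 2 * a + 1 by ring,
    show x + (1 - a + 1) = x + 1 - a + 1 by ring,
    Gamma_add_one ha'.ne', Gamma_add_one (by linarith : 2 - 2 * a ≠ 0),
    Gamma_add_one (by linarith : x + 1 - a ≠ 0),
    Gamma_add_one (by linarith : x + 2 - 2 * a ≠ 0)] at h2
  have h3 : Gamma (x + 2 - 2 * a) = (x + 1 - 2 * a) * Gamma (x + 1 - 2 * a) := by
    rw [← Gamma_add_one (by linarith)]; ring_nf
  rw [div_mul_eq_mul_div, h1, h2, h3, show x + 1 - 2 * a + a = x + 1 - a by ring]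
  have g1 := (Gamma_pos_of_pos (by linarith : 0 < x + 1 - 2 * a)).ne'
  have g2 := (Gamma_pos_of_pos (by linarith : 0 < 2 - 2 * a)).ne'
  have g3 : x + 1 - 2 * a ≠ 0 := by linarith
  have g4 : x + 2 - 2 * a ≠ 0 := by linarith
  have g5 : 2 - 2 * a = 2 * (1 - a) := by ring
  have g6 := ha'.ne'
  rw [g5] at g2 ⊢
  field_simp
  ring

lemma nonneg_of_tendsto_zero_of_sub_le {f : ℝ → ℝ} {y₀ : ℝ} (hf : Tendsto f atTop (nhds 0))
    (h : ∀ y, y₀ ≤ y → f (y + 1) ≤ f y) {y : ℝ} (hy : y₀ ≤ y) : 0 ≤ f y := by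
  have hanti : Antitone fun n : ℕ => f (y + n) := antitone_nat_of_succ_le fun n => by
    have := h (y + n) (by linarith [n.cast_nonneg (α := ℝ)])
    rwa [Nat.cast_succ, ← add_assoc]
  have hlim : Tendsto (fun n : ℕ => f (y + n)) atTop (nhds 0) :=
    hf.comp (tendsto_atTop_add_const_left _ _ tendsto_natCast_atTop_atTop)
  simpa using hanti.le_of_tendsto hlim 0

lemma abs_log_one_add_sub_le {t : ℝ} (h0 : 0 ≤ t) (h1 : t ≤ 1 / 2) :
    |log (1 + t) - t + t ^ 2 / 2| ≤ 2 * t ^ 3 := by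
  have h := abs_log_sub_add_sum_range_le (x := -t) (by rw [abs_neg, abs_of_nonneg h0]; linarith) 2
  simp only [Finset.sum_range_succ, Finset.sum_range_zero, abs_neg, abs_of_nonneg h0] at h
  have h2 : t ^ (2 + 1) / (1 - t) ≤ 2 * t ^ 3 := by
    rw [div_le_iff₀ (by linarith), show 2 + 1 = 3 from rfl]
    have := mul_nonneg (pow_nonneg h0 3) (sub_nonneg.2 h1)
    linarith
  refine le_trans (le_of_eq ?_) (h.trans h2)
  congr 1
  norm_num
  ring

/-- The remainder of `log (Γ (y + a) / Γ y)` after its first two asymptotic terms. -/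
noncomputable def logGammaRatioRemainder (a y : ℝ) : ℝ :=
  log (Gamma (y + a)) - log (Gamma y) - a * log y - a * (a - 1) / 2 / y

lemma abs_logGammaRatioRemainder_add_one_sub_le {a y : ℝ} (ha : a ∈ Set.Ioo (0 : ℝ) 1)
    (hy : 2 ≤ y) :
    |logGammaRatioRemainder a (y + 1) - logGammaRatioRemainder a y| ≤
      10 / y ^ 2 - 10 / (y + 1) ^ 2 := by
  obtain ⟨ha0, ha1⟩ := ha
  have hy0 : 0 < y := by linarith
  have e1 := abs_log_one_add_sub_le (t := a / y) (by positivity)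
    (by rw [div_le_iff₀ hy0]; linarith)
  have e2 := abs_log_one_add_sub_le (t := 1 / y) (by positivity)
    (by rw [div_le_iff₀ hy0]; linarith)
  have l1 : log (1 + a / y) = log (y + a) - log y := by
    rw [← log_div (by positivity) (by positivity)]; congr 1; field_simp
  have l2 : log (1 + 1 / y) = log (y + 1) - log y := by
    rw [← log_div (by positivity) (by positivity)]; congr 1; field_simp
  have g1 : log (Gamma (y + 1 + a)) = log (y + a) + log (Gamma (y + a)) := by
    rw [← log_mul (by positivity) (Gamma_pos_of_pos (by positivity)).ne',
      ← Gamma_add_one (by positivity)]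
    ring_nf
  have g2 : log (Gamma (y + 1)) = log y + log (Gamma y) := by
    rw [← log_mul (by positivity) (Gamma_pos_of_pos (by positivity)).ne',
      ← Gamma_add_one (by positivity)]
  have key : logGammaRatioRemainder a (y + 1) - logGammaRatioRemainder a y =
      (log (1 + a / y) - a / y + (a / y) ^ 2 / 2) -
        a * (log (1 + 1 / y) - 1 / y + (1 / y) ^ 2 / 2) +
        a * (1 - a) / 2 / (y ^ 2 * (y + 1)) := by
    rw [logGammaRatioRemainder, logGammaRatioRemainder, g1, g2, l1, l2]
    field_simp
    ring
  have b1 : 2 * (a / y) ^ 3 ≤ 2 / y ^ 3 := by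
    rw [div_pow, ← mul_div_assoc]
    gcongr
    nlinarith [pow_le_one₀ ha0.le ha1.le (n := 3)]
  have b2 : a * (2 * (1 / y) ^ 3) ≤ 2 / y ^ 3 := by
    rw [div_pow, one_pow, mul_one_div]
    exact mul_le_of_le_one_left (by positivity) ha1.le
  have b3 : a * (1 - a) / 2 / (y ^ 2 * (y + 1)) ≤ 1 / y ^ 3 := by
    gcongr
    · nlinarith
    · nlinarith [sq_nonneg y]
  have b3' : 0 ≤ a * (1 - a) / 2 / (y ^ 2 * (y + 1)) := by
    have : 0 < 1 - a := by linarith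
    positivity
  have b4 : 5 / y ^ 3 ≤ 10 / y ^ 2 - 10 / (y + 1) ^ 2 := by
    rw [div_sub_div _ _ (by positivity) (by positivity), div_le_div_iff₀ (by positivity)
      (by positivity)]
    have : 0 ≤ y ^ 2 * (15 * y ^ 2  - 5) := mul_nonneg (sq_nonneg y) (by nlinarith)
    have h3 : 0 < y ^ 3 := by positivity
    have h2 : 0 < y ^ 2 := by positivity
    nlinarith
  have b5 : 2 / y ^ 3 + 2 / y ^ 3 + 1 / y ^ 3 = 5 / y ^ 3 := by ring
  rw [key, abs_le]
  have f1 := abs_le.1 e1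
  have f2 := abs_le.1 e2
  have f3 := mul_le_mul_of_nonneg_left f2.1 ha0.le
  have f4 := mul_le_mul_of_nonneg_left f2.2 ha0.le
  constructor <;> linarith [f1.1, f1.2]

lemma abs_logGammaRatioRemainder_le_one_div {a y : ℝ} (ha : a ∈ Set.Ioo (0 : ℝ) 1) (hy : 0 < y) :
    |logGammaRatioRemainder a y| ≤ 1 / y := by
  obtain ⟨ha0, ha1⟩ := ha
  have h1 := convexOn_log_Gamma.2 (x := y) hy (y := y + 1) (show 0 < y + 1 by positivity)
    (sub_nonneg.2 ha1.le) ha0.le (by ring)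
  have h2 := convexOn_log_Gamma.2 (x := y + a) (show 0 < y + a by positivity) (y := y + a + 1)
    (show 0 < y + a + 1 by positivity) ha0.le (sub_nonneg.2 ha1.le) (by ring)
  have g1 : log (Gamma (y + 1)) = log y + log (Gamma y) := by
    rw [← log_mul (by positivity) (Gamma_pos_of_pos (by positivity)).ne',
      ← Gamma_add_one (by positivity)]
  have g2 : log (Gamma (y + a + 1)) = log (y + a) + log (Gamma (y + a)) := by
    rw [← log_mul (by positivity) (Gamma_pos_of_pos (by positivity)).ne',
      ← Gamma_add_one (by positivity)]
  simp only [smul_eq_mul, Function.comp_apply] at h1 h2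
  rw [show (1 - a) * y + a * (y + 1) = y + a by ring, g1] at h1
  rw [show a * (y + a) + (1 - a) * (y + a + 1) = y + 1 by ring, g1, g2] at h2
  have l1 : log (y + a) - log y ≤ a / y := by
    rw [← log_div (by positivity) (by positivity)]
    refine (log_le_sub_one_of_pos (by positivity)).trans (le_of_eq ?_)
    field_simp
    ring
  have l2 := mul_le_mul_of_nonneg_left l1 (sub_nonneg.2 ha1.le)
  have e : (1 - a) * (a / y) = a * (1 - a) * (1 / y) := by ring
  have e' : a * (a - 1) / 2 / y = - (a * (1 - a) / 2 * (1 / y)) := by ring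
  have hpos : 0 < 1 / y := by positivity
  have q : a * (1 - a) * (1 / y) ≤ 1 * (1 / y) := by gcongr; nlinarith
  have q' : 0 ≤ a * (1 - a) * (1 / y) := by
    have : 0 < 1 - a := by linarith
    positivity
  rw [logGammaRatioRemainder, e', abs_le]
  constructor <;> nlinarith

lemma abs_logGammaRatioRemainder_le {a y : ℝ} (ha : a ∈ Set.Ioo (0 : ℝ) 1) (hy : 2 ≤ y) :
    |logGammaRatioRemainder a y| ≤ 10 / y ^ 2 := by
  have h0 : Tendsto (logGammaRatioRemainder a) atTop (nhds 0) := by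
    refine squeeze_zero_norm' (a := fun y : ℝ => 1 / y) ?_ ?_
    · filter_upwards [eventually_gt_atTop 0] with y hy using
        abs_logGammaRatioRemainder_le_one_div ha hy
    · simpa using tendsto_inv_atTop_zero (𝕜 := ℝ)
  have h1 : Tendsto (fun y : ℝ => 10 / y ^ 2) atTop (nhds 0) :=
    tendsto_const_nhds.div_atTop (tendsto_pow_atTop two_ne_zero)
  have hstep := fun y hy => abs_le.1 (abs_logGammaRatioRemainder_add_one_sub_le (y := y) ha hy)
  have p := nonneg_of_tendsto_zero_of_sub_le
    (f := fun y => 10 / y ^ 2 + logGammaRatioRemainder a y) (by simpa using h1.add h0)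
    (fun y hy => by linarith [(hstep y hy).2]) hy
  have m := nonneg_of_tendsto_zero_of_sub_le
    (f := fun y => 10 / y ^ 2 - logGammaRatioRemainder a y) (by simpa using h1.sub h0)
    (fun y hy => by linarith [(hstep y hy).1]) hy
  rw [abs_le]
  constructor <;> linarith

lemma isBigO_const_div_sub_const_div (c b : ℝ) :
    (fun x : ℝ => c / (x + b) - c / x) =O[atTop] fun x : ℝ => 1 / x ^ 2 := by
  refine IsBigO.of_bound (|c * b| * 2) ?_
  filter_upwards [eventually_gt_atTop (2 * |b|), eventually_gt_atTop 0] with x hx hx0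
  have hb : x / 2 ≤ x + b := by linarith [neg_abs_le b]
  have hxb : 0 < x + b := by linarith
  have e : c / (x + b) - c / x = -(c * b) / (x * (x + b)) := by
    field_simp
    ring
  rw [e, norm_eq_abs, abs_div, abs_neg, abs_of_pos (by positivity : 0 < x * (x + b)),
    norm_of_nonneg (by positivity), mul_assoc, div_eq_mul_one_div]
  gcongr
  rw [mul_one_div, div_le_div_iff₀ (by positivity) (by positivity)]
  nlinarith

lemma isBigO_log_add_sub (b : ℝ) :
    (fun x : ℝ => log (x + b) - log x - b / x) =O[atTop] fun x : ℝ => 1 / x ^ 2 := by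
  refine IsBigO.of_bound (2 * b ^ 2) ?_
  filter_upwards [eventually_gt_atTop (2 * |b|), eventually_gt_atTop 0] with x hx hx0
  have hb : x / 2 ≤ x + b := by linarith [neg_abs_le b]
  have hxb : 0 < x + b := by linarith
  have h1 := log_le_sub_one_of_pos (div_pos hxb hx0)
  have h2 := one_sub_inv_le_log_of_pos (div_pos hxb hx0)
  rw [log_div hxb.ne' hx0.ne'] at h1 h2
  have e1 : (x + b) / x - 1 = b / x := by field_simp; ring
  have e2 : 1 - ((x + b) / x)⁻¹ = b / x - b ^ 2 / (x * (x + b)) := by field_simp; ring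
  have h3 : b ^ 2 / (x * (x + b)) ≤ 2 * b ^ 2 * (1 / x ^ 2) := by
    rw [mul_one_div, div_le_div_iff₀ (by positivity) (by positivity)]
    nlinarith [mul_nonneg (mul_nonneg (sq_nonneg b) hx0.le) (sub_nonneg.2 hb)]
  have h4 : 0 ≤ 2 * b ^ 2 * (1 / x ^ 2) := by positivity
  rw [e1] at h1
  rw [e2] at h2
  rw [norm_eq_abs, norm_of_nonneg (by positivity), abs_le]
  constructor <;> linarith

lemma isBigO_log_Gamma_ratio {a : ℝ} (ha : a ∈ Set.Ioo (0 : ℝ) 1) (b : ℝ) :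
    (fun x : ℝ => log (Gamma (x + b + a) / Gamma (x + b)) - a * log x -
      (a * (a - 1) / 2 + a * b) / x) =O[atTop] fun x : ℝ => 1 / x ^ 2 := by
  have h1 : (fun x : ℝ => logGammaRatioRemainder a (x + b)) =O[atTop] fun x : ℝ => 1 / x ^ 2 := by
    refine IsBigO.of_bound 40 ?_
    filter_upwards [eventually_gt_atTop (2 * |b|), eventually_ge_atTop (2 - b),
      eventually_gt_atTop 0] with x hx hx2 hx0
    have hb : x / 2 ≤ x + b := by linarith [neg_abs_le b]
    have hxb : 0 < x + b := by linarith
    refine (abs_logGammaRatioRemainder_le ha (by linarith)).trans ?_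
    rw [norm_of_nonneg (by positivity), mul_one_div, div_le_div_iff₀ (by positivity)
      (by positivity)]
    nlinarith
  refine ((h1.add ((isBigO_log_add_sub b).const_mul_left a)).add
    (isBigO_const_div_sub_const_div (a * (a - 1) / 2) b)).congr' ?_ .rfl
  filter_upwards [eventually_gt_atTop (-b)] with x hx
  have hxb : 0 < x + b := by linarith
  have hxa := Gamma_pos_of_pos (add_pos hxb ha.1)
  rw [log_div hxa.ne' (Gamma_pos_of_pos hxb).ne', logGammaRatioRemainder]
  ring

lemma isBigO_one_div_sq_one_div :
    (fun x : ℝ => 1 / x ^ 2) =O[atTop] fun x : ℝ => 1 / x := by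
  refine IsBigO.of_bound 1 ?_
  filter_upwards [eventually_ge_atTop 1] with x hx
  rw [norm_of_nonneg (by positivity), norm_of_nonneg (by positivity), one_mul]
  gcongr
  nlinarith

lemma isBigO_exp_sub_one_sub {L : ℝ → ℝ} {k : ℝ}
    (hL : (fun x => L x - k / x) =O[atTop] fun x : ℝ => 1 / x ^ 2) :
    (fun x => exp (L x) - 1 - k / x) =O[atTop] fun x : ℝ => 1 / x ^ 2 := by
  have hk : (fun x : ℝ => k / x) =O[atTop] fun x : ℝ => 1 / x := by
    simpa [div_eq_mul_inv] using (isBigO_refl (fun x : ℝ => x⁻¹) atTop).const_mul_left k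
  have hL1 : L =O[atTop] fun x : ℝ => 1 / x := by
    simpa using (hL.trans isBigO_one_div_sq_one_div).add hk
  have h0 : Tendsto L atTop (nhds 0) :=
    hL1.trans_tendsto (by simpa using tendsto_inv_atTop_zero (𝕜 := ℝ))
  have hexp : (fun x => exp (L x) - 1 - L x) =O[atTop] fun x : ℝ => 1 / x ^ 2 := by
    refine IsBigO.trans (IsBigO.of_bound 1 ?_) ((hL1.pow 2).congr_right fun x => by ring)
    filter_upwards [h0.abs.eventually_le_const (by simp : |(0 : ℝ)| < 1)] with x hx
    rw [one_mul, norm_pow, norm_eq_abs, norm_eq_abs, sq_abs]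
    exact abs_exp_sub_one_sub_id_le hx
  exact (hexp.add hL).congr_left fun x => by ring

/-- Two-term asymptotics of a ratio of Gamma functions. -/
lemma isBigO_Gamma_ratio {a : ℝ} (ha : a ∈ Set.Ioo (0 : ℝ) 1) (b : ℝ) :
    (fun x : ℝ => Gamma (x + b + a) / Gamma (x + b) / x ^ a - 1 -
      (a * (a - 1) / 2 + a * b) / x) =O[atTop] fun x : ℝ => 1 / x ^ 2 := by
  refine (isBigO_exp_sub_one_sub (isBigO_log_Gamma_ratio ha b)).congr' ?_ .rfl
  filter_upwards [eventually_gt_atTop (-b), eventually_gt_atTop 0] with x hx hx0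
  have hxb : 0 < x + b := by linarith
  have hxa := Gamma_pos_of_pos (add_pos hxb ha.1)
  rw [exp_sub, exp_log (div_pos hxa (Gamma_pos_of_pos hxb)), rpow_def_of_pos hx0, mul_comm a]

lemma isBigO_ford_factor (a : ℝ) :
    (fun x : ℝ => (x + 1 - a) / ((x + 1 - 2 * a) * (x + 2 - 2 * a)) - 1 / x)
      =O[atTop] fun x : ℝ => 1 / x ^ 2 := by
  have h1 := (isBigO_const_div_sub_const_div a (1 - 2 * a)).add
    (isBigO_const_div_sub_const_div (1 - a) (2 - 2 * a))
  refine h1.congr' ?_ .rfl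
  filter_upwards [eventually_gt_atTop (2 * a), eventually_gt_atTop 0] with x hx hx0
  have key : ∀ y : ℝ, y ≠ 0 → y + 1 ≠ 0 →
      (y + a) / (y * (y + 1)) = a / y + (1 - a) / (y + 1) := fun y h0 h1 => by
    field_simp
    ring
  have h := key (x + (1 - 2 * a)) (by linarith) (by linarith)
  rw [show x + (1 - 2 * a) + a = x + 1 - a by ring,
    show x + (1 - 2 * a) + 1 = x + (2 - 2 * a) by ring] at h
  rw [add_sub_assoc x 1 (2 * a), add_sub_assoc x 2, h]
  ring

/-- for `a ∈ (0,1)`, Ford's alpha-model splitting exponent satisfies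
`(a/Γ(1−a)) ∫₀¹ (1−u^x)u^{−a}(1−u)^{−a−1} du + ((2−4a)/Γ(1−a)) ∫₀¹ (1−u^x)u^{1−a}(1−u)^{−a} du
 = x^a − ((3/2)a² − (9/2)a + 2)x^{a−1} + O(x^{a−2})` as `x → ∞`. -/
theorem ford_phi_asymptotic (a : ℝ) (ha : a ∈ Set.Ioo (0:ℝ) 1) :
    (fun x : ℝ =>
        (a / Real.Gamma (1 - a)) *
            (∫ u in (0:ℝ)..1, (1 - u ^ x) * u ^ (-a) * (1 - u) ^ (-a - 1))
          + ((2 - 4 * a) / Real.Gamma (1 - a)) *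
            (∫ u in (0:ℝ)..1, (1 - u ^ x) * u ^ (1 - a) * (1 - u) ^ (-a))
          - (x ^ a - ((3/2) * a ^ 2 - (9/2) * a + 2) * x ^ (a - 1)))
      =O[atTop] (fun x : ℝ => x ^ (a - 2)) := by
  set k : ℝ := a * (a - 1) / 2 + a * (1 - 2 * a)
  set m : ℝ := 2 - 4 * a
  set E : ℝ → ℝ := fun x => (x + 1 - a) / ((x + 1 - 2 * a) * (x + 2 - 2 * a))
  set Q : ℝ → ℝ := fun x => Gamma (x + (1 - 2 * a) + a) / Gamma (x + (1 - 2 * a)) / x ^ a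
  have hQ : (fun x => Q x - 1 - k / x) =O[atTop] fun x : ℝ => 1 / x ^ 2 :=
    isBigO_Gamma_ratio ha (1 - 2 * a)
  have hE : (fun x => E x - 1 / x) =O[atTop] fun x : ℝ => 1 / x ^ 2 := isBigO_ford_factor a
  have hinv : (fun x : ℝ => 1 / x) =O[atTop] fun _ => (1 : ℝ) :=
    (by simpa using tendsto_inv_atTop_zero (𝕜 := ℝ) :
      Tendsto (fun x : ℝ => 1 / x) atTop (nhds 0)).isBigO_one ℝ
  have hE1 : E =O[atTop] fun _ => (1 : ℝ) := by
    simpa using (hE.trans (isBigO_one_div_sq_one_div.trans hinv)).add hinv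
  have h1 : (fun x => 1 - m * E x) =O[atTop] fun _ => (1 : ℝ) :=
    (isBigO_refl _ _).sub (hE1.const_mul_left m)
  have h2 : (fun x : ℝ => 1 + k * (1 / x)) =O[atTop] fun _ => (1 : ℝ) :=
    (isBigO_refl _ _).add (hinv.const_mul_left k)
  have h3 : (fun x : ℝ => (Q x - 1 - k / x) * (1 - m * E x) -
      m * ((1 + k * (1 / x)) * (E x - 1 / x)) - k * m * (1 / x ^ 2))
      =O[atTop] fun x : ℝ => 1 / x ^ 2 := by
    refine IsBigO.sub (IsBigO.sub ?_ (IsBigO.const_mul_left ?_ m))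
      ((isBigO_refl _ _).const_mul_left _)
    · simpa using hQ.mul h1
    · simpa using h2.mul hE
  refine ((isBigO_refl (fun x : ℝ => x ^ a) atTop).mul h3).congr' ?_ ?_
  · filter_upwards [eventually_ge_atTop 1] with x hx
    have hx0 : 0 < x := by linarith
    have hxa : x ^ a ≠ 0 := (rpow_pos_of_pos hx0 a).ne'
    have hR : Gamma (x + 1 - 2 * a + a) / Gamma (x + 1 - 2 * a) = x ^ a * Q x := by
      rw [add_sub_assoc]
      exact (mul_div_cancel₀ _ hxa).symm
    rw [ford_phi_eq ha.2 hx, hR, rpow_sub_one hx0.ne', mul_div_assoc (2 - 4 * a)]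
    change _ = x ^ a * Q x * (1 - m * E x) - _
    have hkm : 3 / 2 * a ^ 2 - 9 / 2 * a + 2 = m - k := by ring
    rw [hkm]
    ring
  · filter_upwards [eventually_gt_atTop 0] with x hx
    rw [rpow_sub hx, rpow_two, mul_one_div]
end

section
/- Let β ∈ (−2,−1). Then as x → ∞ (x real), (−1/Γ(1+β)) · ∫₀¹ (1 − u^x) · u^{β+1} · (1−u)^{β} du = x^{−β−1} − Γ(β+2)/Γ(2β+3) − ((β+1)(3β+4)/2)·x^{−β−2} + O(x^{−β−3}). (The integral converges: near u = 1 the factor 1 − u^x vanishes linearly, giving an integrable singularity (1−u)^{β+1} with β+1 > −1, and near u = 0 the exponent β+1 exceeds −1. Note Γ(1+β) < 0 for β ∈ (−2,−1); at β = −3/2 the constant term Γ(β+2)/Γ(2β+3) is interpreted as 0 since Γ(0) = 0 and division by zero yields 0.) -/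
open Filter Asymptotics Real

theorem log_add_sub_log_sub_bounds {s m : ℝ} (hs₀ : 0 ≤ s) (hs₁ : s ≤ 1) (hm : 0 < m) :
    s / (m + 1 / 2) ≤ log (m + (1 + s) / 2) - log (m + (1 - s) / 2) ∧
      log (m + (1 + s) / 2) - log (m + (1 - s) / 2) ≤ s * (log (m + 1) - log m) := by
  have hlog : ∀ r : ℝ, 0 ≤ r → r ≤ 1 →
      HasSum (fun k : ℕ => (2 : ℝ) * (1 / (2 * k + 1)) * (r / (2 * m + 1)) ^ (2 * k + 1))
        (log (m + (1 + r) / 2) - log (m + (1 - r) / 2)) := by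
    intro r hr₀ hr₁
    have hr : r / (2 * m + 1) < 1 := by rw [div_lt_one (by positivity)]; linarith
    have h := hasSum_log_sub_log_of_abs_lt_one (x := r / (2 * m + 1))
      (by rwa [abs_of_nonneg (by positivity)])
    convert h using 1
    rw [show m + (1 + r) / 2 = (m + 1 / 2) * (1 + r / (2 * m + 1)) by field_simp; ring,
      show m + (1 - r) / 2 = (m + 1 / 2) * (1 - r / (2 * m + 1)) by field_simp; ring,
      log_mul (by positivity) (by positivity), log_mul (by positivity) (by linarith)]
    ring
  have hsum := hlog s hs₀ hs₁
  constructor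
  · refine le_trans (le_of_eq ?_) (le_hasSum hsum 0 fun k _ => by positivity)
    simp
    field_simp
  · have h := (hlog 1 zero_le_one le_rfl).mul_left s
    norm_num at h
    rw [mul_sub]
    rw [mul_sub] at h
    refine hasSum_le (fun k => ?_) hsum h
    have hpow : s ^ (2 * k + 1) ≤ s := pow_le_of_le_one hs₀ hs₁ (by omega)
    rw [div_pow]
    have : 0 ≤ ((2 * m + 1) ^ (2 * k + 1))⁻¹ * (2 * (1 / (2 * (k : ℝ) + 1))) := by positivity
    have := mul_le_mul_of_nonneg_left hpow this
    simp only [div_eq_mul_inv, one_mul] at *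
    linarith

theorem log_add_one_sub_log_le {m : ℝ} (hm : 0 < m) :
    log (m + 1) - log m ≤ 1 / (m + 1 / 2) + (1 / m ^ 2 - 1 / (m + 1) ^ 2) := by
  rw [← log_div (by positivity) hm.ne']
  have hge : 1 ≤ (m + 1) / m := by rw [one_le_div hm]; linarith
  have h := self_le_sinh_iff.2 (log_nonneg hge)
  rw [sinh_log (by positivity)] at h
  refine h.trans (sub_nonneg.1 ?_)
  have : 1 / (m + 1 / 2) + (1 / m ^ 2 - 1 / (m + 1) ^ 2) - ((m + 1) / m - ((m + 1) / m)⁻¹) / 2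
      = (7 * m ^ 2 + 7 * m + 2) / (2 * m ^ 2 * (m + 1) ^ 2 * (2 * m + 1)) := by
    field_simp
    ring
  rw [this]
  positivity

/-- The logarithmic error in approximating a ratio of Gamma functions by a power of the midpoint. -/
noncomputable def logGammaRatioError (s m : ℝ) : ℝ :=
  log (Gamma (m + (1 + s) / 2)) - log (Gamma (m + (1 - s) / 2)) - s * log m

theorem logGammaRatioError_add_one {s m : ℝ} (hs₀ : 0 < s) (hs₁ : s < 1) (hm : 0 < m) :
    logGammaRatioError s (m + 1) = logGammaRatioError s m +
      (log (m + (1 + s) / 2) - log (m + (1 - s) / 2) - s * (log (m + 1) - log m)) := by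
  have h₁ : 0 < m + (1 + s) / 2 := by linarith
  have h₂ : 0 < m + (1 - s) / 2 := by linarith
  simp only [logGammaRatioError]
  rw [show m + 1 + (1 + s) / 2 = m + (1 + s) / 2 + 1 by ring,
    show m + 1 + (1 - s) / 2 = m + (1 - s) / 2 + 1 by ring,
    Gamma_add_one h₁.ne', Gamma_add_one h₂.ne', log_mul h₁.ne' (Gamma_pos_of_pos h₁).ne',
    log_mul h₂.ne' (Gamma_pos_of_pos h₂).ne']
  ring

theorem log_Gamma_add_le {s y : ℝ} (hs₀ : 0 < s) (hs₁ : s < 1) (hy : 0 < y) :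
    log (Gamma (y + s)) ≤ log (Gamma y) + s * log y := by
  have h := convexOn_log_Gamma.2 (Set.mem_Ioi.2 hy) (Set.mem_Ioi.2 (by linarith : 0 < y + 1))
    (sub_nonneg.2 hs₁.le) hs₀.le (by ring)
  simp only [smul_eq_mul, Function.comp_apply] at h
  rw [show (1 - s) * y + s * (y + 1) = y + s by ring, Gamma_add_one hy.ne',
    log_mul hy.ne' (Gamma_pos_of_pos hy).ne'] at h
  linarith

theorem tendsto_logGammaRatioError {s : ℝ} (hs₀ : 0 < s) (hs₁ : s < 1) :
    Tendsto (logGammaRatioError s) atTop (nhds 0) := by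
  have hlog : ∀ c : ℝ, Tendsto (fun m => log (m + c) - log m) atTop (nhds 0) :=
    tendsto_log_comp_add_sub_log
  have hlower := (hlog ((1 - s) / 2)).sub ((hlog ((1 + s) / 2)).const_mul (1 - s))
  have hupper := (hlog ((1 - s) / 2)).const_mul s
  simp only [mul_zero, sub_zero] at hlower hupper
  refine tendsto_of_tendsto_of_tendsto_of_le_of_le' hlower hupper ?_ ?_
  · filter_upwards [eventually_gt_atTop 0] with m hm
    have h₁ : 0 < m + (1 - s) / 2 := by linarith
    have h := log_Gamma_add_le (s := 1 - s) (y := m + (1 + s) / 2) (by linarith) (by linarith)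
      (by linarith)
    rw [show m + (1 + s) / 2 + (1 - s) = m + (1 - s) / 2 + 1 by ring, Gamma_add_one h₁.ne',
      log_mul h₁.ne' (Gamma_pos_of_pos h₁).ne'] at h
    simp only [logGammaRatioError]
    linarith
  · filter_upwards [eventually_gt_atTop 0] with m hm
    have h := log_Gamma_add_le (y := m + (1 - s) / 2) hs₀ hs₁ (by linarith)
    rw [show m + (1 - s) / 2 + s = m + (1 + s) / 2 by ring] at h
    simp only [logGammaRatioError]
    linarith

theorem logGammaRatioError_bounds {s m : ℝ} (hs₀ : 0 < s) (hs₁ : s < 1) (hm : 0 < m) :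
    0 ≤ logGammaRatioError s m ∧ logGammaRatioError s m ≤ s / m ^ 2 := by
  have hshift : Tendsto (fun n : ℕ => m + n) atTop atTop :=
    tendsto_atTop_add_const_left _ _ tendsto_natCast_atTop_atTop
  have hlim := (tendsto_logGammaRatioError hs₀ hs₁).comp hshift
  have hsq : Tendsto (fun n : ℕ => s / (m + n) ^ 2) atTop (nhds 0) :=
    ((tendsto_pow_atTop two_ne_zero).comp hshift).const_div_atTop s
  constructor
  · have hanti : Antitone (logGammaRatioError s ∘ fun n : ℕ => m + n) := by
      refine antitone_nat_of_succ_le fun n => ?_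
      have hn : 0 < m + n := by positivity
      have h := (log_add_sub_log_sub_bounds hs₀.le hs₁.le hn).2
      simp only [Function.comp_apply, Nat.cast_add, Nat.cast_one, ← add_assoc]
      rw [logGammaRatioError_add_one hs₀ hs₁ hn]
      linarith
    simpa using hanti.le_of_tendsto hlim 0
  · have hmono : Monotone fun n : ℕ =>
        (logGammaRatioError s ∘ fun n : ℕ => m + n) n - s / (m + n) ^ 2 := by
      refine monotone_nat_of_le_succ fun n => ?_
      have hn : 0 < m + n := by positivity
      have h₁ := (log_add_sub_log_sub_bounds hs₀.le hs₁.le hn).1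
      have h₂ := mul_le_mul_of_nonneg_left (log_add_one_sub_log_le hn) hs₀.le
      simp only [Function.comp_apply, Nat.cast_add, Nat.cast_one, ← add_assoc]
      rw [logGammaRatioError_add_one hs₀ hs₁ hn]
      simp only [mul_add, mul_sub, mul_one_div] at h₂ ⊢
      linarith
    have h := hmono.ge_of_tendsto (hlim.sub hsq) 0
    simp only [Function.comp_apply, Nat.cast_zero, add_zero, sub_zero] at h
    linarith

theorem abs_one_add_rpow_sub_le {s v : ℝ} (hs₀ : 0 ≤ s) (hs₁ : s ≤ 1) (hv : |v| ≤ 1 / 2) :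
    |(1 + v) ^ s - (1 + s * v)| ≤ v ^ 2 := by
  obtain ⟨hv₁, hv₂⟩ := abs_le.1 hv
  have hpos : 0 < 1 + v := by linarith
  have hupper := rpow_one_add_le_one_add_mul_self (by linarith : -1 ≤ v) hs₀ hs₁
  have hcompl := rpow_one_add_le_one_add_mul_self (by linarith : -1 ≤ v)
    (sub_nonneg.2 hs₁) (by linarith : 1 - s ≤ 1)
  have hprod : (1 + v) ^ s * (1 + v) ^ (1 - s) = 1 + v := by
    rw [← rpow_add hpos]; simp
  have hd : 1 / 2 ≤ 1 + (1 - s) * v := by nlinarith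
  have hmul : 1 + v ≤ (1 + v) ^ s * (1 + (1 - s) * v) := by
    exact hprod.symm.le.trans (mul_le_mul_of_nonneg_left hcompl (rpow_nonneg hpos.le _))
  rw [abs_le]
  refine ⟨?_, by nlinarith⟩
  have : (1 + s * v - v ^ 2) * (1 + (1 - s) * v) ≤ (1 + v) ^ s * (1 + (1 - s) * v) := by
    refine le_trans ?_ hmul
    have : s * (1 - s) ≤ 1 / 4 := by nlinarith [sq_nonneg (s - 1 / 2)]
    nlinarith [mul_nonneg (sq_nonneg v) (by linarith : 0 ≤ 1 + (1 - s) * v - s * (1 - s))]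
  have := le_of_mul_le_mul_right this (by linarith)
  linarith

theorem Gamma_ratio_asymptotic {s c : ℝ} (hs₀ : 0 < s) (hs₁ : s < 1) :
    (fun x : ℝ => Gamma (x + c + (1 + s) / 2) / Gamma (x + c + (1 - s) / 2)
        - (x ^ s + s * c * x ^ (s - 1))) =O[atTop] (fun x : ℝ => x ^ (s - 2)) := by
  refine IsBigO.of_bound (16 + c ^ 2) ?_
  filter_upwards [eventually_ge_atTop 2, eventually_ge_atTop (2 * |c|)] with x hx₂ hxc
  have hx : 0 < x := by linarith
  obtain ⟨hc₁, hc₂⟩ := abs_le.1 (le_refl |c|)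
  set m := x + c with hm_def
  have hm : x / 2 ≤ m := by linarith
  have hm₀ : 0 < m := by linarith
  have hm₁ : 1 ≤ m := by linarith
  obtain ⟨hL₀, hL₁⟩ := logGammaRatioError_bounds hs₀ hs₁ hm₀
  set L := logGammaRatioError s m with hL
  have hratio : Gamma (m + (1 + s) / 2) / Gamma (m + (1 - s) / 2) = m ^ s * exp L := by
    have h₁ := Gamma_pos_of_pos (by linarith : 0 < m + (1 + s) / 2)
    have h₂ := Gamma_pos_of_pos (by linarith : 0 < m + (1 - s) / 2)
    rw [rpow_def_of_pos hm₀, ← exp_add, hL, logGammaRatioError,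
      show log m * s + (log (Gamma (m + (1 + s) / 2)) - log (Gamma (m + (1 - s) / 2)) - s * log m)
        = log (Gamma (m + (1 + s) / 2)) - log (Gamma (m + (1 - s) / 2)) by ring,
      exp_sub, exp_log h₁, exp_log h₂]
  have hLx : L ≤ 4 / x ^ 2 := by
    refine hL₁.trans ?_
    rw [div_le_div_iff₀ (by positivity) (by positivity)]
    nlinarith
  have hLone : L ≤ 1 := hLx.trans (by rw [div_le_one (by positivity)]; nlinarith)
  have hexp : |exp L - 1| ≤ 8 / x ^ 2 := by
    refine (abs_exp_sub_one_le (abs_le.2 ⟨by linarith, hLone⟩)).trans ?_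
    rw [abs_of_nonneg hL₀]
    linarith [show 8 / x ^ 2 = 2 * (4 / x ^ 2) by ring]
  have hv : |c / x| ≤ 1 / 2 := by
    rw [abs_div, abs_of_pos hx, div_le_iff₀ hx]; linarith
  have hv' := abs_le.1 hv
  have hpow := abs_one_add_rpow_sub_le hs₀.le hs₁.le hv
  have hms : m ^ s = x ^ s * (1 + c / x) ^ s := by
    rw [← mul_rpow hx.le (by linarith), hm_def]
    congr 1
    field_simp
  have hle : (1 + c / x) ^ s ≤ 2 := by
    have := rpow_one_add_le_one_add_mul_self (by linarith : -1 ≤ c / x) hs₀.le hs₁.le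
    nlinarith
  have hx1 : x ^ (s - 1) = x ^ s / x := rpow_sub_one hx.ne' s
  have hx2 : x ^ (s - 2) = x ^ s / x ^ 2 := by
    rw [rpow_sub hx]; norm_cast
  have hxs : 0 < x ^ s := rpow_pos_of_pos hx s
  have hfactor : Gamma (m + (1 + s) / 2) / Gamma (m + (1 - s) / 2)
        - (x ^ s + s * c * x ^ (s - 1)) =
      x ^ s * ((1 + c / x) ^ s * (exp L - 1) + ((1 + c / x) ^ s - (1 + s * (c / x)))) := by
    rw [hratio, hms, hx1]; ring
  rw [hfactor, hx2, norm_mul, norm_of_nonneg hxs.le,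
    norm_of_nonneg (by positivity : 0 ≤ x ^ s / x ^ 2)]
  have hw : 0 ≤ (1 + c / x) ^ s := rpow_nonneg (by linarith) s
  calc x ^ s * ‖(1 + c / x) ^ s * (exp L - 1) + ((1 + c / x) ^ s - (1 + s * (c / x)))‖
      ≤ x ^ s * (2 * (8 / x ^ 2) + (c / x) ^ 2) := by
        refine mul_le_mul_of_nonneg_left ((norm_add_le _ _).trans (add_le_add ?_ hpow)) hxs.le
        rw [norm_mul, norm_of_nonneg hw]
        exact mul_le_mul hle hexp (abs_nonneg _) (by norm_num)
    _ = (16 + c ^ 2) * (x ^ s / x ^ 2) := by ring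

theorem ofReal_betaIntegrand {a b u : ℝ} (hu : u ∈ Set.Icc (0 : ℝ) 1) :
    (u : ℂ) ^ ((a : ℂ) - 1) * (1 - (u : ℂ)) ^ ((b : ℂ) - 1)
      = ((u ^ (a - 1) * (1 - u) ^ (b - 1) : ℝ) : ℂ) := by
  rw [Complex.ofReal_mul, Complex.ofReal_cpow hu.1, Complex.ofReal_cpow (sub_nonneg.2 hu.2)]
  push_cast
  rfl

theorem intervalIntegrable_betaIntegrand {a b : ℝ} (ha : 0 < a) (hb : 0 < b) :
    IntervalIntegrable (fun u : ℝ => u ^ (a - 1) * (1 - u) ^ (b - 1)) MeasureTheory.volume 0 1 := by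
  have h := Complex.betaIntegral_convergent (u := a) (v := b) (by simpa) (by simpa)
  rw [intervalIntegrable_iff] at h ⊢
  refine MeasureTheory.IntegrableOn.congr_fun h.re (fun u hu => ?_) measurableSet_uIoc
  rw [Set.uIoc_of_le zero_le_one] at hu
  rw [ofReal_betaIntegrand (Set.Ioc_subset_Icc_self hu)]
  simp

theorem integral_betaIntegrand {a b : ℝ} (ha : 0 < a) (hb : 0 < b) :
    ∫ u in (0 : ℝ)..1, u ^ (a - 1) * (1 - u) ^ (b - 1) = Gamma a * Gamma b / Gamma (a + b) := by
  have h : Complex.betaIntegral a b =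
      ((∫ u in (0 : ℝ)..1, u ^ (a - 1) * (1 - u) ^ (b - 1) : ℝ) : ℂ) := by
    rw [Complex.betaIntegral, ← intervalIntegral.integral_ofReal]
    refine intervalIntegral.integral_congr fun u hu => ?_
    rw [Set.uIcc_of_le zero_le_one] at hu
    exact ofReal_betaIntegrand hu
  have h' := ProbabilityTheory.beta_eq_betaIntegralReal a b ha hb
  rw [h, Complex.ofReal_re] at h'
  exact h'.symm

theorem one_sub_rpow_le_mul_one_sub {x u : ℝ} (hx : 1 ≤ x) (hu : 0 ≤ u) :
    1 - u ^ x ≤ x * (1 - u) := by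
  have h := one_add_mul_self_le_rpow_one_add (s := u - 1) (by linarith) hx
  rw [add_sub_cancel] at h
  linarith

theorem abs_one_sub_rpow_le {x u : ℝ} (hx : 1 ≤ x) (hu : u ∈ Set.Icc (0 : ℝ) 1) :
    |1 - u ^ x| ≤ x * (1 - u) := by
  rw [abs_of_nonneg (sub_nonneg.2 (rpow_le_one hu.1 hu.2 (by linarith)))]
  exact one_sub_rpow_le_mul_one_sub hx hu.1

theorem intervalIntegrable_splitting {β x : ℝ} (hβ : β ∈ Set.Ioo (-2 : ℝ) (-1)) (hx : 1 ≤ x) :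
    IntervalIntegrable (fun u : ℝ => (1 - u ^ x) * u ^ (β + 1) * (1 - u) ^ β)
      MeasureTheory.volume 0 1 := by
  have h := (intervalIntegrable_betaIntegrand (a := β + 2) (b := β + 2)
    (by linarith [hβ.1]) (by linarith [hβ.1])).const_mul x
  refine h.mono_fun (Measurable.aestronglyMeasurable (by fun_prop)) ?_
  rw [Set.uIoc_of_le zero_le_one, ← MeasureTheory.restrict_Ioo_eq_restrict_Ioc]
  filter_upwards [MeasureTheory.ae_restrict_mem measurableSet_Ioo] with u hu
  have hu' : 0 < 1 - u := sub_pos.2 hu.2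
  have hpow : (1 - u) ^ (β + 2 - 1) = (1 - u) ^ β * (1 - u) := by
    rw [← rpow_add_one hu'.ne']; ring_nf
  rw [hpow, show β + 2 - 1 = β + 1 by ring]
  simp only [norm_mul]
  rw [norm_of_nonneg (by linarith : 0 ≤ x), norm_of_nonneg hu'.le]
  calc ‖1 - u ^ x‖ * ‖u ^ (β + 1)‖ * ‖(1 - u) ^ β‖
      ≤ (x * (1 - u)) * ‖u ^ (β + 1)‖ * ‖(1 - u) ^ β‖ := by
        gcongr
        exact abs_one_sub_rpow_le hx (Set.Ioo_subset_Icc_self hu)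
    _ = _ := by ring

theorem hasDerivAt_splitting_primitive {β x u : ℝ} (hu : u ∈ Set.Ioo (0 : ℝ) 1) :
    HasDerivAt (fun u : ℝ => (1 - u ^ x) * u ^ (β + 2) * (1 - u) ^ (β + 1))
      ((2 * β + 3) * (u ^ (β + 2 - 1) * (1 - u) ^ (β + 2 - 1))
        - (x + 2 * β + 3) * (u ^ (x + β + 2 - 1) * (1 - u) ^ (β + 2 - 1))
        - (β + 1) * ((1 - u ^ x) * u ^ (β + 1) * (1 - u) ^ β)) u := by
  have hu₁ : 0 < 1 - u := sub_pos.2 hu.2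
  have h₁ := (hasDerivAt_rpow_const (p := x) (Or.inl hu.1.ne')).const_sub 1
  have h₂ := hasDerivAt_rpow_const (p := β + 2) (Or.inl hu.1.ne')
  have h₃ := ((hasDerivAt_id u).const_sub 1).rpow_const (p := β + 1) (Or.inl hu₁.ne')
  refine ((h₁.mul h₂).mul h₃).congr_deriv ?_
  simp only [id, Pi.mul_apply]
  have e₁ : (1 - u) ^ (β + 2 - 1) = (1 - u) ^ β * (1 - u) := by
    rw [← rpow_add_one hu₁.ne']; ring_nf
  have e₂ : (1 - u) ^ (β + 1) = (1 - u) ^ β * (1 - u) := rpow_add_one hu₁.ne' _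
  have e₃ : (1 - u) ^ (β + 1 - 1) = (1 - u) ^ β := by ring_nf
  have e₄ : u ^ (x + β + 2 - 1) = u ^ x * u ^ (β + 1) := by
    rw [← rpow_add hu.1]; ring_nf
  have e₅ : u ^ (β + 2) = u ^ (β + 1) * u := by
    rw [← rpow_add_one hu.1.ne']; ring_nf
  have e₆ : u ^ (β + 2 - 1) = u ^ (β + 1) := by ring_nf
  have e₇ : u ^ (x - 1) = u ^ x / u := rpow_sub_one hu.1.ne' _
  rw [e₁, e₂, e₃, e₄, e₅, e₆, e₇]
  have := hu.1.ne'
  field_simp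
  ring

theorem tendsto_splitting_primitive_zero {β x : ℝ} (hβ : -2 < β) (hx : 1 ≤ x) :
    Tendsto (fun u : ℝ => (1 - u ^ x) * u ^ (β + 2) * (1 - u) ^ (β + 1))
      (nhdsWithin 0 (Set.Ioi 0)) (nhds 0) := by
  have hc : ContinuousAt (fun u : ℝ => (1 - u ^ x) * u ^ (β + 2) * (1 - u) ^ (β + 1)) 0 := by
    refine ((continuousAt_const.sub (continuousAt_rpow_const _ _ (Or.inr (by linarith)))).mul
      (continuousAt_rpow_const _ _ (Or.inr (by linarith)))).mul
      (ContinuousAt.rpow_const (by fun_prop) (Or.inl (by norm_num)))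
  have h := hc.tendsto.mono_left (nhdsWithin_le_nhds (s := Set.Ioi 0))
  simpa [zero_rpow (by linarith : β + 2 ≠ 0)] using h

theorem tendsto_splitting_primitive_one {β x : ℝ} (hβ : -2 < β) (hx : 1 ≤ x) :
    Tendsto (fun u : ℝ => (1 - u ^ x) * u ^ (β + 2) * (1 - u) ^ (β + 1))
      (nhdsWithin 1 (Set.Iio 1)) (nhds 0) := by
  have hbound : Tendsto (fun u : ℝ => x * (1 - u) ^ (β + 2))
      (nhdsWithin 1 (Set.Iio 1)) (nhds 0) := by
    have hc : ContinuousAt (fun u : ℝ => x * (1 - u) ^ (β + 2)) 1 :=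
      continuousAt_const.mul (ContinuousAt.rpow_const (by fun_prop) (Or.inr (by linarith)))
    have h := hc.tendsto.mono_left (nhdsWithin_le_nhds (s := Set.Iio 1))
    simpa [zero_rpow (by linarith : β + 2 ≠ 0)] using h
  refine squeeze_zero_norm' ?_ hbound
  filter_upwards [Ioo_mem_nhdsLT (zero_lt_one' ℝ)] with u hu
  have hu₁ : 0 < 1 - u := sub_pos.2 hu.2
  have hpow : (1 - u) ^ (β + 2) = (1 - u) * (1 - u) ^ (β + 1) := by
    rw [mul_comm, ← rpow_add_one hu₁.ne']; ring_nf
  rw [hpow, norm_mul, norm_mul, norm_of_nonneg (rpow_nonneg hu.1.le _),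
    norm_of_nonneg (rpow_nonneg hu₁.le _), ← mul_assoc]
  refine mul_le_mul_of_nonneg_right ?_ (rpow_nonneg hu₁.le _)
  calc ‖1 - u ^ x‖ * u ^ (β + 2) ≤ (x * (1 - u)) * 1 := by
        refine mul_le_mul (abs_one_sub_rpow_le hx (Set.Ioo_subset_Icc_self hu))
          (rpow_le_one hu.1.le hu.2.le (by linarith)) (rpow_nonneg hu.1.le _) (by positivity)
    _ = _ := mul_one _

theorem Gamma_div_Gamma_add_one (a b : ℝ) (hb : 0 < b + 1) :
    Gamma a / Gamma b = b * (Gamma a / Gamma (b + 1)) := by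
  rcases eq_or_ne b 0 with rfl | h
  · simp
  · rw [Gamma_add_one h]
    field_simp

/-- Closed form of the splitting exponent of the beta-splitting fragmentation. -/
theorem splitting_integral_eq {β x : ℝ} (hβ : β ∈ Set.Ioo (-2 : ℝ) (-1)) (hx : 1 ≤ x) :
    (-1 / Gamma (1 + β)) * (∫ u in (0 : ℝ)..1, (1 - u ^ x) * u ^ (β + 1) * (1 - u) ^ β) =
      Gamma (x + β + 2) / Gamma (x + 2 * β + 3) - Gamma (β + 2) / Gamma (2 * β + 3) := by
  obtain ⟨hβ₁, hβ₂⟩ := hβ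
  have hb : 0 < β + 2 := by linarith
  have hI₁ := (intervalIntegrable_betaIntegrand hb hb).const_mul (2 * β + 3)
  have hI₂ := (intervalIntegrable_betaIntegrand (a := x + β + 2) (by linarith) hb).const_mul
    (x + 2 * β + 3)
  have hI₃ := (intervalIntegrable_splitting ⟨hβ₁, hβ₂⟩ hx).const_mul (β + 1)
  have h := intervalIntegral.integral_eq_sub_of_hasDerivAt_of_tendsto zero_lt_one
    (fun u hu => hasDerivAt_splitting_primitive hu) ((hI₁.sub hI₂).sub hI₃)
    (tendsto_splitting_primitive_zero hβ₁ hx) (tendsto_splitting_primitive_one hβ₁ hx)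
  rw [intervalIntegral.integral_sub (hI₁.sub hI₂) hI₃, intervalIntegral.integral_sub hI₁ hI₂,
    intervalIntegral.integral_const_mul, intervalIntegral.integral_const_mul,
    intervalIntegral.integral_const_mul, integral_betaIntegrand hb hb,
    integral_betaIntegrand (by linarith : 0 < x + β + 2) hb] at h
  have hne : β + 1 ≠ 0 := by linarith
  have hG : Gamma (β + 2) = (β + 1) * Gamma (1 + β) := by
    rw [show β + 2 = β + 1 + 1 by ring, Gamma_add_one hne, add_comm 1 β]
  have hG₀ : Gamma (β + 2) ≠ 0 := (Gamma_pos_of_pos hb).ne'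
  have hG₁ : Gamma (1 + β) = Gamma (β + 2) / (β + 1) := by rw [hG]; field_simp
  rw [Gamma_div_Gamma_add_one _ (2 * β + 3) (by linarith),
    Gamma_div_Gamma_add_one _ (x + 2 * β + 3) (by linarith), hG₁]
  rw [show β + 2 + (β + 2) = 2 * β + 3 + 1 by ring,
    show x + β + 2 + (β + 2) = x + 2 * β + 3 + 1 by ring] at h
  set I := ∫ u in (0 : ℝ)..1, (1 - u ^ x) * u ^ (β + 1) * (1 - u) ^ β
  have hI : (β + 1) * I = (2 * β + 3) * (Gamma (β + 2) * Gamma (β + 2) / Gamma (2 * β + 3 + 1))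
      - (x + 2 * β + 3) * (Gamma (x + β + 2) * Gamma (β + 2) / Gamma (x + 2 * β + 3 + 1)) := by
    linarith
  rw [show -1 / (Gamma (β + 2) / (β + 1)) * I = -((β + 1) * I) / Gamma (β + 2) by field_simp, hI]
  field_simp
  ring

/-- for `β ∈ (−2,−1)`, the beta-splitting model exponent satisfies
`(−1/Γ(1+β)) ∫₀¹ (1−u^x)u^{β+1}(1−u)^β du
 = x^{−β−1} − Γ(β+2)/Γ(2β+3) − ((β+1)(3β+4)/2)x^{−β−2} + O(x^{−β−3})` as `x → ∞`.
(At `β = −3/2`, `Γ(2β+3) = Γ(0) = 0` and the quotient is `0` by the convention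
`x/0 = 0`, matching the interpretation in the statement.) -/
theorem beta_splitting_phi_asymptotic (β : ℝ) (hβ : β ∈ Set.Ioo (-2 : ℝ) (-1)) :
    (fun x : ℝ =>
        (-1 / Real.Gamma (1 + β)) *
            (∫ u in (0:ℝ)..1, (1 - u ^ x) * u ^ (β + 1) * (1 - u) ^ β)
          - (x ^ (-β - 1) - Real.Gamma (β + 2) / Real.Gamma (2 * β + 3)
              - ((β + 1) * (3 * β + 4) / 2) * x ^ (-β - 2)))
      =O[atTop] (fun x : ℝ => x ^ (-β - 3)) := by
  have hΓ := Gamma_ratio_asymptotic (s := -β - 1) (c := (3 * β + 4) / 2)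
    (by linarith [hβ.2]) (by linarith [hβ.1])
  rw [show -β - 1 - 2 = -β - 3 by ring] at hΓ
  refine hΓ.congr' ?_ EventuallyEq.rfl
  filter_upwards [eventually_ge_atTop 1] with x hx
  rw [splitting_integral_eq hβ hx,
    show x + (3 * β + 4) / 2 + (1 + (-β - 1)) / 2 = x + β + 2 by ring,
    show x + (3 * β + 4) / 2 + (1 - (-β - 1)) / 2 = x + 2 * β + 3 by ring,
    show -β - 1 - 1 = -β - 2 by ring]
  ring
end
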